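/- arXiv:1803.10740 — 5 statements merged into one kernel-verified Lean document; each statement's English description precedes it below -/
import Mathlib

section
/- For every x ∈ ℝⁿ and all nonnegative scalars w₁, w₂, one has w₁·Σ_{i=1}^n |x_i| + w₂·Σ_{1≤i<j≤n} max{|x_i|, |x_j|} = Σ_{i=1}^n (w₁ + w₂(n−i))·|x|_i^↓, i.e. the OSCAR penalty equals the decreasing weighted sorted ℓ₁ function with weights λ_i = w₁ + w₂(n−i). -/
open Matrix

/-- `absDown x` is the vector of the absolute values of the entries of `x`
arranged in non-increasing order, i.e. `|x|^↓`. -/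
noncomputable def absDown {n : ℕ} (x : Fin n → ℝ) : Fin n → ℝ :=
  fun i => |x (Tuple.sort (fun k => -|x k|) i)|

/-- The decreasing weighted sorted ℓ₁ (DWSL1) function `κ_λ(x) = ∑ λ_i |x|_i^↓`. -/
noncomputable def kappa {n : ℕ} (lam x : Fin n → ℝ) : ℝ :=
  ∑ i, lam i * absDown x i

/-- A signed permutation matrix: exactly one nonzero entry in each row and
each column, and every entry is `0`, `1` or `-1`. -/
def IsSignedPerm {n : ℕ} (π : Matrix (Fin n) (Fin n) ℝ) : Prop :=
  (∀ i, ∃! j, π i j ≠ 0) ∧ (∀ j, ∃! i, π i j ≠ 0) ∧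
    ∀ i j, π i j = 0 ∨ π i j = 1 ∨ π i j = -1

/-- The matrix `B` with `(Bx)_i = x_i - x_{i+1}` for `i < n-1` and `(Bx)_{n-1} = x_{n-1}`. -/
def Bmat (n : ℕ) : Matrix (Fin n) (Fin n) ℝ :=
  Matrix.of fun i j => if j = i then 1 else if (j : ℕ) = (i : ℕ) + 1 then -1 else 0

/-- `B_Γ`: the submatrix of `B` consisting of the rows indexed by `Γ`. -/
def Brows {n : ℕ} (Γ : Finset (Fin n)) : Matrix {i // i ∈ Γ} (Fin n) ℝ :=
  Matrix.of fun i j => Bmat n i.1 j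

/-- `P = Iₙ - B_Γᵀ (B_Γ B_Γᵀ)⁻¹ B_Γ`. -/
noncomputable def Pmat {n : ℕ} (Γ : Finset (Fin n)) : Matrix (Fin n) (Fin n) ℝ :=
  1 - (Brows Γ)ᵀ * (Brows Γ * (Brows Γ)ᵀ)⁻¹ * Brows Γ

/-- The Euclidean norm on `Fin n → ℝ`. -/
noncomputable def eucNorm {n : ℕ} (x : Fin n → ℝ) : ℝ := Real.sqrt (∑ i, (x i) ^ 2)

/-- Membership in the set `C_λ = {z : ∑_{j ≤ i} |z|_j^↓ ≤ ∑_{j ≤ i} λ_j for all i}`. -/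
def memC {n : ℕ} (lam z : Fin n → ℝ) : Prop :=
  ∀ i : Fin n, ∑ j ∈ Finset.Iic i, absDown z j ≤ ∑ j ∈ Finset.Iic i, lam j

theorem two_mul_sum_filter_lt {n : ℕ} (f : Fin n → Fin n → ℝ) (hf : ∀ i j, f i j = f j i) :
    2 * ∑ p ∈ Finset.univ.filter (fun p : Fin n × Fin n => p.1 < p.2), f p.1 p.2
      = (∑ i, ∑ j, f i j) - ∑ i, f i i := by
  have hdiag : ∑ i, f i i = ∑ i, ∑ j, if i = j then f i j else 0 := by simp
  have hswap : ∑ i, ∑ j, (if i < j then f i j else 0)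
      = ∑ i, ∑ j, (if j < i then f i j else 0) := by
    rw [Finset.sum_comm]
    simp only [hf]
  have hsplit : ∑ i, ∑ j, f i j = (∑ i, ∑ j, if i < j then f i j else 0)
      + (∑ i, ∑ j, if j < i then f i j else 0) + ∑ i, ∑ j, if i = j then f i j else 0 := by
    simp only [← Finset.sum_add_distrib]
    refine Finset.sum_congr rfl fun i _ => Finset.sum_congr rfl fun j _ => ?_
    rcases lt_trichotomy i j with h | h | h
    · simp [h, h.ne, h.not_gt]
    · simp [h]
    · simp [h, h.ne', h.not_gt]
  rw [hdiag, Finset.sum_filter, Fintype.sum_prod_type]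
  linarith

theorem sum_filter_lt_comp_perm {n : ℕ} (f : Fin n → Fin n → ℝ) (hf : ∀ i j, f i j = f j i)
    (σ : Equiv.Perm (Fin n)) :
    ∑ p ∈ Finset.univ.filter (fun p : Fin n × Fin n => p.1 < p.2), f (σ p.1) (σ p.2)
      = ∑ p ∈ Finset.univ.filter (fun p : Fin n × Fin n => p.1 < p.2), f p.1 p.2 := by
  have h := two_mul_sum_filter_lt f hf
  have hσ := two_mul_sum_filter_lt (fun i j => f (σ i) (σ j)) fun i j => hf _ _
  have hsum : ∑ i, ∑ j, f (σ i) (σ j) = ∑ i, ∑ j, f i j := by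
    rw [← Equiv.sum_comp σ fun i => ∑ j, f i j]
    exact Finset.sum_congr rfl fun i _ => Equiv.sum_comp σ (f (σ i))
  have hdiag : ∑ i, f (σ i) (σ i) = ∑ i, f i i := Equiv.sum_comp σ fun i => f i i
  linarith

theorem sum_filter_lt_max_of_antitone {n : ℕ} {a : Fin n → ℝ} (ha : Antitone a) :
    ∑ p ∈ Finset.univ.filter (fun p : Fin n × Fin n => p.1 < p.2), max (a p.1) (a p.2)
      = ∑ i : Fin n, ((n : ℝ) - (((i : ℕ) : ℝ) + 1)) * a i := by
  rw [Finset.sum_filter, Fintype.sum_prod_type]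
  refine Finset.sum_congr rfl fun i _ => ?_
  have hmax : ∀ j, (if i < j then max (a i) (a j) else 0) = if i < j then a i else 0 := by
    intro j
    split_ifs with h
    · exact max_eq_left (ha h.le)
    · rfl
  have hcard : (Finset.univ.filter fun j => i < j) = Finset.Ioi i := by
    ext j
    simp
  simp only [hmax]
  rw [← Finset.sum_filter, Finset.sum_const, hcard, Fin.card_Ioi, nsmul_eq_mul, Nat.sub_sub,
    Nat.cast_sub (by omega)]
  push_cast
  ring

theorem absDown_antitone {n : ℕ} (x : Fin n → ℝ) : Antitone (absDown x) := by
  intro i j hij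
  exact neg_le_neg_iff.mp (Tuple.monotone_sort (fun k => -|x k|) hij)

theorem sum_absDown {n : ℕ} (x : Fin n → ℝ) : ∑ i, absDown x i = ∑ i, |x i| :=
  Equiv.sum_comp (Tuple.sort fun k => -|x k|) fun i => |x i|

/-- The OSCAR penalty equals the decreasing weighted sorted ℓ₁ function with
weights `λ_i = w₁ + w₂ (n - i)` (1-based `i`). -/
theorem stmt0 {n : ℕ} (x : Fin n → ℝ) (w₁ w₂ : ℝ) (hw₁ : 0 ≤ w₁) (hw₂ : 0 ≤ w₂) :
    w₁ * (∑ i, |x i|) +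
      w₂ * ∑ p ∈ Finset.univ.filter (fun p : Fin n × Fin n => p.1 < p.2),
        max |x p.1| |x p.2|
    = ∑ i : Fin n, (w₁ + w₂ * ((n : ℝ) - (((i : ℕ) : ℝ) + 1))) * absDown x i := by
  have hmax : ∑ p ∈ Finset.univ.filter (fun p : Fin n × Fin n => p.1 < p.2),
      max (absDown x p.1) (absDown x p.2)
      = ∑ p ∈ Finset.univ.filter (fun p : Fin n × Fin n => p.1 < p.2), max |x p.1| |x p.2| :=
    sum_filter_lt_comp_perm (fun i j => max |x i| |x j|) (fun i j => max_comm _ _)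
      (Tuple.sort fun k => -|x k|)
  rw [← hmax, sum_filter_lt_max_of_antitone (absDown_antitone x), ← sum_absDown,
    Finset.mul_sum, Finset.mul_sum, ← Finset.sum_add_distrib]
  exact Finset.sum_congr rfl fun i _ => by ring
end

section
/- Let λ ∈ ℝⁿ satisfy λ_1 ≥ λ_2 ≥ ⋯ ≥ λ_n ≥ 0. For z ∈ ℝⁿ, the inequality ⟨z, x⟩ ≤ κ_λ(x) holds for every x ∈ ℝⁿ if and only if Σ_{j=1}^i |z|_j^↓ ≤ Σ_{j=1}^i λ_j for every i = 1, …, n; that is, the set C_λ is exactly the set of vectors whose linear functional is dominated by κ_λ. -/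
open Matrix

/-- Nonnegative partial sums stay nonnegative when weighted by a nonnegative antitone sequence. -/
theorem sum_mul_nonneg_of_antitone {n : ℕ} (d a : Fin n → ℝ) (ha : Antitone a)
    (ha0 : ∀ i, 0 ≤ a i) (hd : ∀ i, 0 ≤ ∑ j ∈ Finset.Iic i, d j) : 0 ≤ ∑ i, d i * a i := by
  induction n with
  | zero => simp
  | succ n ih =>
    have key : ∑ i, d i * a i = (∑ i : Fin n, d i.castSucc * (a i.castSucc - a (Fin.last n)))
        + a (Fin.last n) * ∑ i, d i := by
      simp only [Fin.sum_univ_castSucc, mul_sub, Finset.sum_sub_distrib, ← Finset.sum_mul]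
      ring
    rw [key]
    refine add_nonneg (ih _ _ ?_ ?_ ?_) (mul_nonneg (ha0 _) ?_)
    · intro i j hij
      exact sub_le_sub_right (ha (Fin.castSucc_le_castSucc_iff.2 hij)) _
    · intro i
      exact sub_nonneg.2 (ha (Fin.le_last _))
    · intro i
      have h := hd i.castSucc
      rwa [← Fin.map_castSuccEmb_Iic, Finset.sum_map] at h
    · have h := hd (Fin.last n)
      rwa [← Fin.top_eq_last, Finset.Iic_top] at h

theorem absDown_nonneg {n : ℕ} (x : Fin n → ℝ) (i : Fin n) : 0 ≤ absDown x i := abs_nonneg _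

theorem sum_mul_le_sum_absDown_mul {n : ℕ} (z x : Fin n → ℝ) :
    ∑ i, z i * x i ≤ ∑ i, absDown z i * absDown x i := by
  set σ := Tuple.sort (fun k => -|z k|) with hσ
  set τ := Tuple.sort (fun k => -|x k|) with hτ
  calc ∑ i, z i * x i ≤ ∑ i, |z i| * |x i| :=
        Finset.sum_le_sum fun i _ => (le_abs_self _).trans (abs_mul _ _).le
    _ = ∑ i, |z (σ i)| * |x (σ i)| := (Equiv.sum_comp σ fun i => |z i| * |x i|).symm
    _ = ∑ i, absDown z i * absDown x ((σ.trans τ.symm) i) := by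
        simp [absDown, ← hσ, ← hτ]
    _ ≤ ∑ i, absDown z i * absDown x i :=
        ((absDown_antitone z).monovary (absDown_antitone x)).sum_mul_comp_perm_le_sum_mul

/-- If the entries of `x` lie in `[-1, 1]` and `∑ |x_k| ≤ i + 1`, then `κ_λ(x)` is at most
the sum of the `i + 1` largest weights. -/
theorem kappa_le_sum_Iic {n : ℕ} (lam : Fin n → ℝ) (hmono : Antitone lam)
    (hpos : ∀ i, 0 ≤ lam i) (x : Fin n → ℝ) (i : Fin n) (hx : ∀ k, |x k| ≤ 1)
    (hsum : ∑ k, |x k| ≤ (i : ℝ) + 1) : kappa lam x ≤ ∑ j ∈ Finset.Iic i, lam j := by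
  have hterm : ∀ j, lam j * absDown x j - (if j ≤ i then lam j else 0)
      ≤ lam i * (absDown x j - if j ≤ i then 1 else 0) := by
    intro j
    have h1 : absDown x j ≤ 1 := hx _
    have h0 := absDown_nonneg x j
    split_ifs with h
    · nlinarith [hmono h]
    · nlinarith [hmono (not_le.1 h).le]
  have hle := Finset.sum_le_sum fun j (_ : j ∈ Finset.univ) => hterm j
  have hfilter : Finset.univ.filter (fun j => j ≤ i) = Finset.Iic i := by ext; simp
  rw [← Finset.mul_sum, Finset.sum_sub_distrib, Finset.sum_sub_distrib, sum_absDown,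
    ← Finset.sum_filter, ← Finset.sum_filter, hfilter, Finset.sum_const, Fin.card_Iic] at hle
  simp only [nsmul_eq_mul, mul_one, Nat.cast_add, Nat.cast_one] at hle
  have := mul_nonpos_of_nonneg_of_nonpos (hpos i) (sub_nonpos.2 hsum)
  unfold kappa
  linarith

/-- `⟨z, x⟩ ≤ κ_λ(x)` for all `x` iff `z ∈ C_λ`. -/
theorem stmt3 {n : ℕ} (lam : Fin n → ℝ) (hmono : Antitone lam) (hpos : ∀ i, 0 ≤ lam i)
    (z : Fin n → ℝ) :
    (∀ x : Fin n → ℝ, ∑ i, z i * x i ≤ kappa lam x) ↔ memC lam z := by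
  constructor
  · intro h i
    set σ := Tuple.sort (fun k => -|z k|) with hσ
    have hfilter : Finset.univ.filter (fun j => j ≤ i) = Finset.Iic i := by ext; simp
    let x : Fin n → ℝ := fun k => if σ.symm k ≤ i then SignType.sign (z k) else 0
    have hx : ∀ k, |x k| ≤ if σ.symm k ≤ i then 1 else 0 := by
      intro k
      simp only [x]
      split_ifs
      · rcases lt_trichotomy (z k) 0 with hz | hz | hz <;> simp [hz]
      · simp
    have hx1 : ∀ k, |x k| ≤ 1 := fun k => (hx k).trans (by split_ifs <;> norm_num)
    have hsum : ∑ k, |x k| ≤ (i : ℝ) + 1 := by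
      refine (Finset.sum_le_sum fun k _ => hx k).trans ?_
      rw [Equiv.sum_comp σ.symm fun j => if j ≤ i then (1 : ℝ) else 0, ← Finset.sum_filter,
        hfilter]
      simp
    have hzx : ∑ k, z k * x k = ∑ j ∈ Finset.Iic i, absDown z j := by
      rw [← Equiv.sum_comp σ, ← hfilter, Finset.sum_filter]
      refine Finset.sum_congr rfl fun j _ => ?_
      simp [x, absDown, ← hσ, self_mul_sign]
    exact hzx ▸ (h x).trans (kappa_le_sum_Iic lam hmono hpos x i hx1 hsum)
  · intro h x
    refine (sum_mul_le_sum_absDown_mul z x).trans ?_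
    have key := sum_mul_nonneg_of_antitone (fun j => lam j - absDown z j) (absDown x)
      (absDown_antitone x) (absDown_nonneg x) fun i => by
        simpa [Finset.sum_sub_distrib] using h i
    simpa [kappa, sub_mul, Finset.sum_sub_distrib] using key
end

section
/- Let λ ∈ ℝⁿ satisfy λ_1 ≥ λ_2 ≥ ⋯ ≥ λ_n ≥ 0, and let w ∈ ℝⁿ satisfy w_1 ≥ w_2 ≥ ⋯ ≥ w_n ≥ 0. If u minimizes the function x ↦ ½‖x − w‖² + ⟨λ, x⟩ over the cone K = {x ∈ ℝⁿ : x_1 ≥ x_2 ≥ ⋯ ≥ x_n ≥ 0}, then u also minimizes the function x ↦ ½‖x − w‖² + κ_λ(x) over all of ℝⁿ; i.e., for non-increasingly sorted nonnegative input the proximal point of κ_λ coincides with the monotone-cone-constrained minimizer. -/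
open Matrix

theorem sum_absDown_sq {n : ℕ} (x : Fin n → ℝ) : ∑ i, absDown x i ^ 2 = ∑ i, x i ^ 2 := by
  simp only [absDown, sq_abs]
  exact Equiv.sum_comp (Tuple.sort (fun k => -|x k|)) (fun i => x i ^ 2)

theorem sum_mul_abs_le_sum_mul_absDown {n : ℕ} {w : Fin n → ℝ} (hw : Antitone w)
    (x : Fin n → ℝ) : ∑ i, w i * |x i| ≤ ∑ i, w i * absDown x i := by
  have h := (hw.monovary (absDown_antitone x)).sum_mul_comp_perm_le_sum_mul
    (σ := (Tuple.sort (fun k => -|x k|))⁻¹)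
  simpa [absDown] using h

theorem kappa_le_of_antitone {n : ℕ} {lam u : Fin n → ℝ} (hlam : Antitone lam)
    (hu : Antitone u) (hu0 : ∀ i, 0 ≤ u i) : kappa lam u ≤ ∑ i, lam i * u i := by
  simp only [kappa, absDown, abs_of_nonneg (hu0 _)]
  exact (hlam.monovary hu).sum_mul_comp_perm_le_sum_mul

/-- Sorting the absolute values does not increase the distance to a nonnegative
non-increasing vector. -/
theorem sum_absDown_sub_sq_le {n : ℕ} {w : Fin n → ℝ} (hw : Antitone w) (hw0 : ∀ i, 0 ≤ w i)
    (x : Fin n → ℝ) : ∑ i, (absDown x i - w i) ^ 2 ≤ ∑ i, (x i - w i) ^ 2 := by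
  have expand (z : Fin n → ℝ) :
      ∑ i, (z i - w i) ^ 2 = ∑ i, z i ^ 2 - 2 * ∑ i, w i * z i + ∑ i, w i ^ 2 := by
    rw [Finset.mul_sum, ← Finset.sum_sub_distrib, ← Finset.sum_add_distrib]
    exact Finset.sum_congr rfl fun i _ => by ring
  have habs : ∑ i, w i * x i ≤ ∑ i, w i * |x i| :=
    Finset.sum_le_sum fun i _ => mul_le_mul_of_nonneg_left (le_abs_self _) (hw0 i)
  have hsort := sum_mul_abs_le_sum_mul_absDown hw x
  rw [expand, expand, sum_absDown_sq]
  linarith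

/-- For non-increasingly sorted nonnegative input `w`, any minimizer of
`½‖x - w‖² + ⟨λ, x⟩` over the monotone nonnegative cone minimizes
`½‖x - w‖² + κ_λ(x)` over all of `ℝⁿ`. -/
theorem stmt4 {n : ℕ} (lam : Fin n → ℝ) (hmono : Antitone lam) (hpos : ∀ i, 0 ≤ lam i)
    (w : Fin n → ℝ) (hwmono : Antitone w) (hwpos : ∀ i, 0 ≤ w i)
    (u : Fin n → ℝ) (huK : Antitone u ∧ ∀ i, 0 ≤ u i)
    (hmin : ∀ x : Fin n → ℝ, (Antitone x ∧ ∀ i, 0 ≤ x i) →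
      (1 / 2) * ∑ i, (u i - w i) ^ 2 + ∑ i, lam i * u i ≤
        (1 / 2) * ∑ i, (x i - w i) ^ 2 + ∑ i, lam i * x i) :
    ∀ x : Fin n → ℝ,
      (1 / 2) * ∑ i, (u i - w i) ^ 2 + kappa lam u ≤
        (1 / 2) * ∑ i, (x i - w i) ^ 2 + kappa lam x := by
  intro x
  have hu := kappa_le_of_antitone hmono huK.1 huK.2
  have hx := hmin (absDown x) ⟨absDown_antitone x, absDown_nonneg x⟩
  have hd := sum_absDown_sub_sq_le hwmono hwpos x
  have hk : kappa lam x = ∑ i, lam i * absDown x i := rfl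
  linarith
end

section
/- Let B ∈ ℝ^{n×n} be the matrix with (Bx)_i = x_i − x_{i+1} for i = 1, …, n−1 and (Bx)_n = x_n. Let 1 ≤ l ≤ u < n and Γ = {l, l+1, …, u}, and set P = Iₙ − B_Γᵀ (B_Γ B_Γᵀ)⁻¹ B_Γ. Then for every x ∈ ℝⁿ, (Px)_j = (1/(u − l + 2)) · Σ_{k=l}^{u+1} x_k for every j with l ≤ j ≤ u+1, and (Px)_j = x_j for every j ∉ {l, …, u+1}; i.e., P averages the coordinates l through u+1 and acts as the identity on all other coordinates. -/
open Matrix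

lemma isUnit_Bmat (n : ℕ) : IsUnit (Bmat n) := by
  have htri : (Bmat n).BlockTriangular id := fun i j hij => by
    have hij' : (j : ℕ) < i := hij
    simp only [Bmat, Matrix.of_apply, Fin.ext_iff]
    rw [if_neg (by omega), if_neg (by omega)]
  rw [Matrix.isUnit_iff_isUnit_det, Matrix.det_of_isUpperTriangular htri]
  simp [Bmat]

/-- The rows of `B` are linearly independent, so every Gram matrix `B_Γ B_Γᵀ` is invertible. -/
lemma isUnit_det_Brows_mul_transpose {n : ℕ} (Γ : Finset (Fin n)) :
    IsUnit (Brows Γ * (Brows Γ)ᵀ).det := by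
  have hrows : LinearIndependent ℝ (Brows Γ).row :=
    (Matrix.linearIndependent_rows_iff_isUnit.mpr (isUnit_Bmat n)).comp _
      Subtype.val_injective
  have hpos := Matrix.PosDef.mul_conjTranspose_self (Brows Γ)
    (Matrix.vecMul_injective_iff.mpr hrows)
  rw [Matrix.conjTranspose_eq_transpose_of_trivial] at hpos
  exact hpos.det_pos.ne'.isUnit

/-- `P` is the projection onto `ker B_Γ` along the range of `B_Γᵀ`. -/
lemma Pmat_mulVec_add {n : ℕ} (Γ : Finset (Fin n)) (y : Fin n → ℝ)
    (z : {i // i ∈ Γ} → ℝ) (hy : Brows Γ *ᵥ y = 0) :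
    Pmat Γ *ᵥ (y + (Brows Γ)ᵀ *ᵥ z) = y := by
  rw [Pmat, Matrix.sub_mulVec, Matrix.one_mulVec, ← Matrix.mulVec_mulVec, Matrix.mulVec_add, hy,
    zero_add, Matrix.mulVec_mulVec, Matrix.mulVec_mulVec, Matrix.mul_assoc _ (Brows Γ),
    Matrix.nonsing_inv_mul_cancel_right _ _ (isUnit_det_Brows_mul_transpose Γ),
    add_sub_cancel_right]

lemma Bmat_apply {n : ℕ} (i j : Fin n) :
    Bmat n i j = (if j = i then 1 else 0) - if (j : ℕ) = i + 1 then 1 else 0 := by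
  simp only [Bmat, Matrix.of_apply, Fin.ext_iff]
  split_ifs <;> first | omega | norm_num

lemma Brows_mulVec_apply {n : ℕ} (Γ : Finset (Fin n)) (y : Fin n → ℝ) (i : {i // i ∈ Γ})
    (j : Fin n) (hj : (j : ℕ) = i.1 + 1) : (Brows Γ *ᵥ y) i = y i.1 - y j := by
  have hcond (k : Fin n) : ((k : ℕ) = i.1 + 1) ↔ k = j := by rw [Fin.ext_iff, hj]
  simp [Brows, Matrix.mulVec, dotProduct, Bmat_apply, sub_mul, Finset.sum_sub_distrib, hcond]

/-- Summation by parts: `B_Γᵀ` turns `i ↦ S (i + 1)` into differences of `S`. -/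
lemma Brows_transpose_mulVec_apply {n l u : ℕ} (Γ : Finset (Fin n))
    (hΓ : Γ = Finset.univ.filter (fun i : Fin n => l ≤ (i : ℕ) ∧ (i : ℕ) ≤ u))
    (S : ℕ → ℝ) (j : Fin n) :
    ((Brows Γ)ᵀ *ᵥ fun i => S (i.1 + 1)) j =
      (if l ≤ (j : ℕ) ∧ (j : ℕ) ≤ u then S (j + 1) else 0) -
        if l + 1 ≤ (j : ℕ) ∧ (j : ℕ) ≤ u + 1 then S j else 0 := by
  have hsum : ((Brows Γ)ᵀ *ᵥ fun i => S (i.1 + 1)) j = ∑ i ∈ Γ, Bmat n i j * S (i + 1) := by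
    simp only [Matrix.mulVec, dotProduct, Brows, Matrix.transpose_apply, Matrix.of_apply]
    exact Finset.sum_coe_sort Γ fun i => Bmat n i j * S (i + 1)
  simp only [hsum, Bmat_apply, sub_mul, Finset.sum_sub_distrib, ite_mul, one_mul, zero_mul]
  congr 1
  · simp [hΓ]
  · split_ifs with h
    · rw [Finset.sum_eq_single ⟨j - 1, by omega⟩]
      · have hpred : (j : ℕ) - 1 + 1 = j := by omega
        simp [hpred]
      · intro i _ hi
        rw [if_neg]
        rw [Ne, Fin.ext_iff] at hi
        simp only at hi
        omega
      · intro hj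
        simp only [hΓ, Finset.mem_filter, Finset.mem_univ, true_and] at hj
        omega
    · refine Finset.sum_eq_zero fun i hi => if_neg ?_
      simp only [hΓ, Finset.mem_filter, Finset.mem_univ, true_and] at hi
      omega

lemma card_filter_le_val_le {n l m : ℕ} (hlm : l ≤ m) (hm : m < n) :
    (Finset.univ.filter (fun k : Fin n => l ≤ (k : ℕ) ∧ (k : ℕ) ≤ m)).card = m + 1 - l := by
  have hIcc : Finset.univ.filter (fun k : Fin n => l ≤ (k : ℕ) ∧ (k : ℕ) ≤ m) =
      Finset.Icc ⟨l, by omega⟩ ⟨m, hm⟩ := by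
    ext k
    simp [Fin.le_def]
  rw [hIcc, Fin.card_Icc]

/-- For `Γ = {l, …, u}` with `l ≤ u < n-1` (0-based; `1 ≤ l ≤ u < n` 1-based),
`P` averages coordinates `l` through `u+1` and is the identity elsewhere. -/
theorem stmt11 {n : ℕ} (l u : ℕ) (hlu : l ≤ u) (hun : u + 1 < n)
    (Γ : Finset (Fin n))
    (hΓ : Γ = Finset.univ.filter (fun i : Fin n => l ≤ (i : ℕ) ∧ (i : ℕ) ≤ u))
    (x : Fin n → ℝ) :
    (∀ j : Fin n, l ≤ (j : ℕ) → (j : ℕ) ≤ u + 1 →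
      (Pmat Γ).mulVec x j =
        (1 / ((u : ℝ) - (l : ℝ) + 2)) *
          ∑ k ∈ Finset.univ.filter (fun k : Fin n => l ≤ (k : ℕ) ∧ (k : ℕ) ≤ u + 1), x k) ∧
    (∀ j : Fin n, ¬(l ≤ (j : ℕ) ∧ (j : ℕ) ≤ u + 1) → (Pmat Γ).mulVec x j = x j) := by
  set a : ℝ := (1 / ((u : ℝ) - (l : ℝ) + 2)) *
    ∑ k ∈ Finset.univ.filter (fun k : Fin n => l ≤ (k : ℕ) ∧ (k : ℕ) ≤ u + 1), x k with ha
  set y : Fin n → ℝ := fun j => if l ≤ (j : ℕ) ∧ (j : ℕ) ≤ u + 1 then a else x j with hy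
  let S : ℕ → ℝ := fun m => ∑ k : Fin n, if l ≤ (k : ℕ) ∧ (k : ℕ) < m then x k - a else 0
  have hS_low : S l = 0 := Finset.sum_eq_zero fun k _ => if_neg (by omega)
  have hS_step (j : Fin n) (hj : l ≤ (j : ℕ)) : S (j + 1) = S j + (x j - a) := by
    have hsingle : x j - a = ∑ k : Fin n, if k = j then x k - a else 0 := by simp
    rw [hsingle, ← Finset.sum_add_distrib]
    refine Finset.sum_congr rfl fun k _ => ?_
    simp only [Fin.ext_iff]
    split_ifs <;> first | omega | simp
  have hS_high : S (u + 2) = 0 := by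
    have hfilter : S (u + 2) =
        ∑ k ∈ Finset.univ.filter (fun k : Fin n => l ≤ (k : ℕ) ∧ (k : ℕ) ≤ u + 1), (x k - a) := by
      rw [Finset.sum_filter]
      exact Finset.sum_congr rfl fun k _ => if_congr (by omega) rfl rfl
    have hlu' : (l : ℝ) ≤ u := by exact_mod_cast hlu
    have hne : (u : ℝ) - l + 2 ≠ 0 := by linarith
    rw [hfilter, Finset.sum_sub_distrib, Finset.sum_const,
      card_filter_le_val_le (by omega) hun, nsmul_eq_mul, Nat.cast_sub (by omega), ha]
    push_cast
    field_simp
    ring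
  have hker : Brows Γ *ᵥ y = 0 := by
    ext i
    have hi := i.2
    simp only [hΓ, Finset.mem_filter, Finset.mem_univ, true_and] at hi
    rw [Brows_mulVec_apply Γ y i ⟨i.1 + 1, by omega⟩ rfl, hy]
    simp only
    rw [if_pos (by omega), if_pos (by omega), sub_self, Pi.zero_apply]
  have hdecomp : x = y + (Brows Γ)ᵀ *ᵥ fun i => S (i.1 + 1) := by
    ext j
    rw [Pi.add_apply, Brows_transpose_mulVec_apply Γ hΓ, hy]
    simp only
    by_cases hj : l ≤ (j : ℕ) ∧ (j : ℕ) ≤ u + 1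
    · have hfirst : (if l ≤ (j : ℕ) ∧ (j : ℕ) ≤ u then S (j + 1) else 0) = S (j + 1) := by
        split_ifs with h
        · rfl
        · rw [show (j : ℕ) + 1 = u + 2 by omega, hS_high]
      have hsecond : (if l + 1 ≤ (j : ℕ) ∧ (j : ℕ) ≤ u + 1 then S j else 0) = S j := by
        split_ifs with h
        · rfl
        · rw [show (j : ℕ) = l by omega, hS_low]
      rw [if_pos hj, hfirst, hsecond, hS_step j hj.1]
      ring
    · rw [if_neg hj, if_neg (by omega), if_neg (by omega)]
      ring
  have hP : Pmat Γ *ᵥ x = y := by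
    conv_lhs => rw [hdecomp]
    exact Pmat_mulVec_add Γ y _ hker
  rw [hP]
  exact ⟨fun j h₁ h₂ => if_pos ⟨h₁, h₂⟩, fun j h => if_neg h⟩
end

section
/- Let B ∈ ℝ^{n×n} be the matrix with (Bx)_i = x_i − x_{i+1} for i = 1, …, n−1 and (Bx)_n = x_n. Let 1 ≤ l ≤ n and Γ = {l, l+1, …, n}, and set P = Iₙ − B_Γᵀ (B_Γ B_Γᵀ)⁻¹ B_Γ. Then for every x ∈ ℝⁿ, (Px)_j = 0 for every j with l ≤ j ≤ n, and (Px)_j = x_j for every j < l; i.e., P zeroes out the coordinates l through n and acts as the identity on all other coordinates. -/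
open Matrix

/-- The principal submatrix of `B` on the index set `Γ`. -/
def Bprincipal {n : ℕ} (Γ : Finset (Fin n)) : Matrix {i // i ∈ Γ} {i // i ∈ Γ} ℝ :=
  Matrix.of fun i j => Bmat n i.1 j.1

/-- Every principal submatrix of `B` is upper unitriangular. -/
theorem det_Bprincipal {n : ℕ} (Γ : Finset (Fin n)) :
    (Bprincipal Γ).det = 1 := by
  rw [Matrix.det_of_isUpperTriangular]
  · simp [Bprincipal, Bmat]
  · intro i j hij
    have hij' : (j.1 : ℕ) < i.1 := hij
    have hne : j.1 ≠ i.1 := fun h => by simp [h] at hij'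
    simp only [Bprincipal, Bmat, of_apply, if_neg hne]
    exact if_neg (by omega)

/-- The coordinate restriction `ℝⁿ → ℝ^Γ`. -/
def coordRestrict {n : ℕ} (Γ : Finset (Fin n)) : Matrix {i // i ∈ Γ} (Fin n) ℝ :=
  Matrix.of fun i j => if i.1 = j then 1 else 0

theorem coordRestrict_mul_transpose {n : ℕ} (Γ : Finset (Fin n)) :
    coordRestrict Γ * (coordRestrict Γ)ᵀ = 1 := by
  ext i j
  simp only [coordRestrict, Matrix.mul_apply, transpose_apply, of_apply, Matrix.one_apply,
    ite_mul, one_mul, zero_mul, Finset.sum_ite_eq, Finset.mem_univ, if_true, Subtype.ext_iff]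
  simp only [eq_comm]

theorem transpose_mul_coordRestrict {n : ℕ} (Γ : Finset (Fin n)) :
    (coordRestrict Γ)ᵀ * coordRestrict Γ = diagonal fun j => if j ∈ Γ then 1 else 0 := by
  ext i j
  simp only [coordRestrict, Matrix.mul_apply, transpose_apply, of_apply, diagonal_apply]
  rw [Finset.sum_coe_sort Γ fun k => (if k = i then (1 : ℝ) else 0) * if k = j then 1 else 0]
  simp only [ite_mul, one_mul, zero_mul, Finset.sum_ite_eq']
  split_ifs <;> rfl

/-- When `Γ` is an upper set, the rows of `B_Γ` are supported in `Γ`. -/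
theorem Brows_eq_mul_coordRestrict {n : ℕ} {Γ : Finset (Fin n)}
    (hΓ : IsUpperSet (Γ : Set (Fin n))) :
    Brows Γ = Bprincipal Γ * coordRestrict Γ := by
  ext i j
  simp only [coordRestrict, Bprincipal, Matrix.mul_apply, Brows, of_apply]
  rw [Finset.sum_coe_sort Γ fun k => Bmat n i.1 k * if k = j then (1 : ℝ) else 0]
  simp only [mul_ite, mul_one, mul_zero, Finset.sum_ite_eq']
  split_ifs with hj
  · rfl
  · have hlt : j < i.1 := lt_of_not_ge fun h => hj (hΓ h i.2)
    have hlt' : (j : ℕ) < i.1 := hlt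
    simp only [Bmat, of_apply, if_neg hlt.ne]
    exact if_neg (by omega)

/-- When `Γ` is an upper set, `P` is the projection killing the coordinates in `Γ`. -/
theorem Pmat_eq_of_isUpperSet {n : ℕ} {Γ : Finset (Fin n)}
    (hΓ : IsUpperSet (Γ : Set (Fin n))) :
    Pmat Γ = 1 - diagonal fun j => if j ∈ Γ then (1 : ℝ) else 0 := by
  have hdet := det_Bprincipal Γ
  rw [Pmat, Brows_eq_mul_coordRestrict hΓ, ← transpose_mul_coordRestrict]
  generalize Bprincipal Γ = C at hdet ⊢
  have hC : IsUnit C.det := by simp [hdet]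
  have hCT : IsUnit Cᵀ.det := by rwa [det_transpose]
  have hgram : C * coordRestrict Γ * (C * coordRestrict Γ)ᵀ = C * Cᵀ := by
    rw [transpose_mul, Matrix.mul_assoc, ← Matrix.mul_assoc (coordRestrict Γ),
      coordRestrict_mul_transpose, Matrix.one_mul]
  rw [hgram, Matrix.mul_inv_rev, transpose_mul]
  congr 1
  calc (coordRestrict Γ)ᵀ * Cᵀ * (Cᵀ⁻¹ * C⁻¹) * (C * coordRestrict Γ)
      = (coordRestrict Γ)ᵀ * (Cᵀ * Cᵀ⁻¹) * (C⁻¹ * C) * coordRestrict Γ := by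
        simp only [Matrix.mul_assoc]
    _ = (coordRestrict Γ)ᵀ * coordRestrict Γ := by
        rw [Matrix.mul_nonsing_inv _ hCT, Matrix.nonsing_inv_mul _ hC, Matrix.mul_one,
          Matrix.mul_one]

/-- For `Γ = {l, …, n-1}` (0-based; `{l, …, n}` 1-based), `P` zeroes out the
coordinates `l` through `n-1` and is the identity on the other coordinates. -/
theorem stmt12 {n : ℕ} (l : ℕ) (hl : l < n)
    (Γ : Finset (Fin n)) (hΓ : Γ = Finset.univ.filter (fun i : Fin n => l ≤ (i : ℕ)))
    (x : Fin n → ℝ) :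
    (∀ j : Fin n, l ≤ (j : ℕ) → (Pmat Γ).mulVec x j = 0) ∧
    (∀ j : Fin n, (j : ℕ) < l → (Pmat Γ).mulVec x j = x j) := by
  have hup : IsUpperSet (Γ : Set (Fin n)) := by
    intro a b hab ha
    have hab' : (a : ℕ) ≤ b := hab
    simp only [hΓ, Finset.coe_filter, Finset.mem_univ, true_and, Set.mem_ofPred_eq] at ha ⊢
    omega
  have hP : ∀ j, (Pmat Γ).mulVec x j = x j - (if j ∈ Γ then 1 else 0) * x j := fun j => by
    rw [Pmat_eq_of_isUpperSet hup, sub_mulVec, one_mulVec, Pi.sub_apply, mulVec_diagonal]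
  refine ⟨fun j hj => ?_, fun j hj => ?_⟩
  · rw [hP]; simp [hΓ, hj]
  · rw [hP]; simp [hΓ, hj]
end
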